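/- arXiv:2106.03561 — 3 statements merged into one kernel-verified Lean document; each statement's English description precedes it below -/
import Mathlib

section
/- Let P be a forcing notion satisfying ccc2 (every antichain in P is countable). Then P satisfies ccc3: every predense subset of P contains a countable predense subset. (In the paper this is proved from DC_{ω₁}, which holds under the axiom of choice.) -/
/-- Two conditions in a forcing notion (a preorder with a greatest element) are
compatible if they have a common lower bound. -/
def Forcing.Compat {P : Type*} [Preorder P] (p q : P) : Prop :=
  ∃ r : P, r ≤ p ∧ r ≤ q

/-- A set of conditions is an antichain if any two distinct members are incompatible. -/
def Forcing.Antichain {P : Type*} [Preorder P] (A : Set P) : Prop :=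
  ∀ p ∈ A, ∀ q ∈ A, p ≠ q → ¬ Forcing.Compat p q

/-- A set is predense if every condition is compatible with some member of it. -/
def Forcing.Predense {P : Type*} [Preorder P] (D : Set P) : Prop :=
  ∀ p : P, ∃ q ∈ D, Forcing.Compat p q

/-- ccc2: every antichain is countable. -/
def Forcing.Ccc2 (P : Type*) [Preorder P] : Prop :=
  ∀ A : Set P, Forcing.Antichain A → A.Countable

/-- ccc3: every predense set contains a countable predense subset. -/
def Forcing.Ccc3 (P : Type*) [Preorder P] : Prop :=
  ∀ D : Set P, Forcing.Predense D →
    ∃ D₀ : Set P, D₀ ⊆ D ∧ D₀.Countable ∧ Forcing.Predense D₀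

/-- Every set of conditions `S` contains an antichain such that each member of `S` is compatible
with some member of the antichain. -/
theorem Forcing.exists_maximal_antichain {P : Type*} [Preorder P] (S : Set P) :
    ∃ A ⊆ S, Forcing.Antichain A ∧ ∀ p ∈ S, ∃ a ∈ A, Forcing.Compat p a := by
  obtain ⟨A, hA⟩ := zorn_subset {A : Set P | A ⊆ S ∧ Forcing.Antichain A} (by
    intro c hc hchain
    refine ⟨⋃₀ c, ⟨Set.sUnion_subset fun B hB => (hc hB).1, ?_⟩,
      fun B hB => Set.subset_sUnion_of_mem hB⟩
    rintro p ⟨B, hB, hpB⟩ q ⟨C, hC, hqC⟩ hpq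
    rcases hchain.total hB hC with hBC | hCB
    · exact (hc hC).2 p (hBC hpB) q hqC hpq
    · exact (hc hB).2 p hpB q (hCB hqC) hpq)
  refine ⟨A, hA.prop.1, hA.prop.2, fun p hp => ?_⟩
  by_contra! hincompat
  have hinsert : Forcing.Antichain (insert p A) := by
    rintro x (rfl | hx) y (rfl | hy) hxy
    · exact absurd rfl hxy
    · exact hincompat y hy
    · rintro ⟨r, hrx, hry⟩
      exact hincompat x hx ⟨r, hry, hrx⟩
    · exact hA.prop.2 x hx y hy hxy
  have hpA : p ∈ A :=
    hA.le_of_ge ⟨Set.insert_subset hp hA.prop.1, hinsert⟩ (Set.subset_insert p A)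
      (Set.mem_insert p A)
  exact hincompat p hpA ⟨p, le_rfl, le_rfl⟩

/-- Under the axiom of choice (hence `DC_{ω₁}`), ccc2 implies ccc3. -/
theorem ccc2_implies_ccc3 (P : Type*) [Preorder P] [OrderTop P]
    (h : Forcing.Ccc2 P) : Forcing.Ccc3 P := by
  intro D hD
  obtain ⟨A, hAD, hA, hmax⟩ := Forcing.exists_maximal_antichain {p : P | ∃ d ∈ D, p ≤ d}
  have hbound : ∀ a ∈ A, ∃ d ∈ D, a ≤ d := fun a ha => hAD ha
  choose! f hfD hf using hbound
  refine ⟨f '' A, Set.image_subset_iff.2 hfD, (h A hA).image f, fun p => ?_⟩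
  obtain ⟨q, hq, r, hrp, hrq⟩ := hD p
  obtain ⟨a, ha, s, hsr, hsa⟩ := hmax r ⟨q, hq, hrq⟩
  exact ⟨f a, Set.mem_image_of_mem f ha, s, hsr.trans hrp, hsa.trans (hf a ha)⟩
end

section
/- Let P be a co-well-founded forcing notion, i.e., the reversed strict order on P (the relation r given by r(q, p) iff p < q) is well-founded. If every maximal antichain in P is countable (ccc1), then every predense subset of P contains a countable predense subset (ccc3). -/
/-- A maximal antichain is an antichain not properly contained in any other antichain. -/
def Forcing.MaxAntichain {P : Type*} [Preorder P] (A : Set P) : Prop :=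
  Forcing.Antichain A ∧ ∀ B : Set P, Forcing.Antichain B → A ⊆ B → A = B

namespace Forcing

variable {P : Type*} [Preorder P]

theorem Compat.symm {p q : P} (h : Compat p q) : Compat q p :=
  let ⟨r, hp, hq⟩ := h
  ⟨r, hq, hp⟩

theorem Predense.maxAntichain {A : Set P} (hA : Antichain A) (hd : Predense A) :
    MaxAntichain A := by
  refine ⟨hA, fun B hB hAB => hAB.antisymm fun b hb => ?_⟩
  obtain ⟨a, ha, hba⟩ := hd b
  by_contra hbA
  exact hB b hb a (hAB ha) (fun h => hbA (h ▸ ha)) hba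

theorem exists_maximal_antichain_subset (S : Set P) :
    ∃ A : Set P, Maximal (fun B => Antichain B ∧ B ⊆ S) A := by
  refine zorn_subset {B : Set P | Antichain B ∧ B ⊆ S} fun c hc hchain =>
    ⟨⋃₀ c, ⟨?_, Set.sUnion_subset fun B hB => (hc hB).2⟩, fun B => Set.subset_sUnion_of_mem⟩
  rintro p ⟨B, hB, hp⟩ q ⟨C, hC, hq⟩
  rcases hchain.total hB hC with h | h
  · exact (hc hC).1 p (h hp) q hq
  · exact (hc hB).1 p hp q (h hq)

/-- Below every predense set there is a predense antichain. -/
theorem Predense.exists_antichain_below {D : Set P} (hD : Predense D) :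
    ∃ A : Set P, Antichain A ∧ Predense A ∧ ∀ a ∈ A, ∃ d ∈ D, a ≤ d := by
  obtain ⟨A, hA⟩ := exists_maximal_antichain_subset {a : P | ∃ d ∈ D, a ≤ d}
  refine ⟨A, hA.prop.1, fun p => ?_, hA.prop.2⟩
  obtain ⟨d, hd, r, hrp, hrd⟩ := hD p
  by_contra! hp
  have hr : ∀ a ∈ A, ¬ Compat r a := fun a ha ⟨s, hsr, hsa⟩ => hp a ha ⟨s, hsr.trans hrp, hsa⟩
  have hins : Antichain (insert r A) := by
    rintro x (rfl | hx) y (rfl | hy) hxy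
    · exact absurd rfl hxy
    · exact hr y hy
    · exact fun h => hr x hx h.symm
    · exact hA.prop.1 x hx y hy hxy
  have hrA : r ∈ A := hA.le_of_ge ⟨hins, Set.insert_subset ⟨d, hd, hrd⟩ hA.prop.2⟩
    (Set.subset_insert r A) (Set.mem_insert r A)
  exact hr r hrA ⟨r, le_rfl, le_rfl⟩

end Forcing

/-- A co-well-founded forcing notion (one whose reversed strict order is well-founded)
satisfying ccc1 (every maximal antichain is countable) satisfies ccc3 (every predense
set contains a countable predense subset). -/
theorem cowellfounded_ccc1_implies_ccc3
    {P : Type*} [Preorder P] [OrderTop P]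
    (hwf : WellFounded (fun q p : P => p < q))
    (hccc1 : ∀ A : Set P, Forcing.MaxAntichain A → A.Countable) :
    ∀ D : Set P, Forcing.Predense D →
      ∃ D₀ : Set P, D₀ ⊆ D ∧ D₀.Countable ∧ Forcing.Predense D₀ := by
  intro D hD
  obtain ⟨A, hA, hAD, hbelow⟩ := hD.exists_antichain_below
  choose! f hfD hf using hbelow
  refine ⟨f '' A, Set.image_subset_iff.2 hfD, (hccc1 A (hAD.maxAntichain hA)).image f, fun p => ?_⟩
  obtain ⟨a, ha, r, hrp, hra⟩ := hAD p
  exact ⟨f a, Set.mem_image_of_mem f ha, r, hrp, hra.trans (hf a ha)⟩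
end

section
/- Let λ be an infinite cardinal and M a set, and call a partial function p from M × λ × λ to 2 a condition if its domain has cardinality strictly less than λ. Then for any two conditions p and q there exists a family (π_m)_{m∈M} of permutations of λ such that the transported condition πp, defined by (πp)(m, π_m(α), β) = p(m, α, β), has domain disjoint from the domain of q; in particular πp and q are compatible (their union is again a condition). -/
universe u

/-- A partial function from `M × L × L` to `2` is modelled as a total function into
`Option (Fin 2)`; its domain is the set where it is not `none`. -/
def CondDom {M L : Type u} (p : M × L × L → Option (Fin 2)) : Set (M × L × L) :=
  {x : M × L × L | p x ≠ none}

/-- The action of a family `(π_m)_{m ∈ M}` of permutations of `L` on a partial function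
`p : M × L × L ⇀ 2`, transporting the middle coordinate:
`(πp)(m, π_m α, β) = p (m, α, β)`. -/
def transport {M L : Type u} (π : M → Equiv.Perm L)
    (p : M × L × L → Option (Fin 2)) : M × L × L → Option (Fin 2) :=
  fun x => p (x.1, (π x.1).symm x.2.1, x.2.2)

open Cardinal in
/-- Over an infinite type, a set of smaller cardinality can be moved off any other set of smaller
cardinality by a permutation. -/
theorem exists_perm_disjoint_image {L : Type u} (hL : ℵ₀ ≤ #L) {A B : Set L}
    (hA : #A < #L) (hB : #B < #L) : ∃ σ : Equiv.Perm L, ∀ a ∈ A, σ a ∉ B := by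
  have : Infinite L := infinite_iff.mpr hL
  have hle : #A ≤ #(Bᶜ : Set L) := by
    rw [mk_compl_of_infinite B hB]
    exact hA.le
  obtain ⟨f⟩ := hle
  obtain ⟨σ, hσ⟩ := extend_function_of_lt (f.trans (Function.Embedding.subtype _)) hA
    ⟨Equiv.refl L⟩
  refine ⟨σ, fun a ha => ?_⟩
  rw [hσ ⟨a, ha⟩]
  exact (f ⟨a, ha⟩).2

/-- Homogeneity lemma: for two conditions `p, q` (partial functions `M × λ × λ ⇀ 2`
with domains of size `< λ`, where `λ` is an infinite cardinal represented by the
type `L`), there is a family of permutations `(π_m)_{m ∈ M}` of `λ` such that the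
transported condition `πp` (which satisfies `(πp)(m, π_m α, β) = p (m, α, β)`) has
domain disjoint from the domain of `q`; in particular `πp` and `q` are compatible:
their union (here `fun x => (transport π p x).orElse (fun _ => q x)`) is again a condition. -/
theorem homogeneity_lemma {M L : Type u} (hL : Cardinal.aleph0 ≤ Cardinal.mk L)
    (p q : M × L × L → Option (Fin 2))
    (hp : Cardinal.mk (CondDom p) < Cardinal.mk L)
    (hq : Cardinal.mk (CondDom q) < Cardinal.mk L) :
    ∃ π : M → Equiv.Perm L,
      (∀ m : M, ∀ α β : L, transport π p (m, (π m) α, β) = p (m, α, β)) ∧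
      CondDom (transport π p) ∩ CondDom q = ∅ ∧
      Cardinal.mk (CondDom (fun x => (transport π p x).orElse (fun _ => q x))) <
        Cardinal.mk L := by
  obtain ⟨σ, hσ⟩ := exists_perm_disjoint_image hL
    (A := (fun x : M × L × L => x.2.1) '' CondDom p)
    (B := (fun x : M × L × L => x.2.1) '' CondDom q)
    (Cardinal.mk_image_le.trans_lt hp) (Cardinal.mk_image_le.trans_lt hq)
  refine ⟨fun _ => σ, fun m α β => by simp [transport], ?_, ?_⟩
  · refine Set.eq_empty_of_forall_notMem fun x ⟨hxp, hxq⟩ => ?_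
    refine hσ (σ.symm x.2.1) ⟨(x.1, σ.symm x.2.1, x.2.2), hxp, rfl⟩ ?_
    rw [Equiv.apply_symm_apply]
    exact ⟨x, hxq, rfl⟩
  · have hsub : CondDom (fun x => (transport (fun _ => σ) p x).orElse (fun _ => q x)) ⊆
        (fun x : M × L × L => (x.1, σ x.2.1, x.2.2)) '' CondDom p ∪ CondDom q := by
      intro x hx
      by_cases h : transport (fun _ => σ) p x = none
      · right
        simpa [CondDom, h] using hx
      · exact Or.inl ⟨(x.1, σ.symm x.2.1, x.2.2), h, by simp⟩
    exact (Cardinal.mk_le_mk_of_subset hsub).trans_lt <| (Cardinal.mk_union_le _ _).trans_lt <|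
      Cardinal.add_lt_of_lt hL (Cardinal.mk_image_le.trans_lt hp) hq
end
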